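/- For every m ≥ 1 there is no sequence of real numbers (a_i)_{i≥1} with a_i ≥ 2 for all i such that the sequence defined by d_0 = 1, d_1 = a_1, d_{i+1} = a_{i+1}·d_i − d_{i−1} satisfies d_{m+1} = 1 and d_{m+2} = 0. Consequently, the entries of the first row of a frieze pattern of width m cannot all be ≥ 2. -/

import Mathlib

/-- A sequence satisfying `d (i + 1) = a (i + 1) * d i - d (i - 1)` with `a i ≥ 2`, `d 0 = 1` and
`d 1 = a 1` is bounded below by `1` and monotone. -/
theorem one_le_and_le_succ_of_diagonal {a d : ℕ → ℝ} (ha : ∀ i, 1 ≤ i → 2 ≤ a i)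
    (h0 : d 0 = 1) (h1 : d 1 = a 1)
    (hd : ∀ i, 1 ≤ i → d (i + 1) = a (i + 1) * d i - d (i - 1)) (i : ℕ) :
    1 ≤ d i ∧ d i ≤ d (i + 1) := by
  induction i with
  | zero =>
    have := ha 1 le_rfl
    constructor <;> simp only [zero_add, h0, h1] <;> linarith
  | succ k ih =>
    have hrec := hd (k + 1) (by omega)
    have ha2 := ha (k + 1 + 1) (by omega)
    rw [Nat.add_sub_cancel] at hrec
    constructor
    · linarith
    · nlinarith

/-- For every `m ≥ 1` there is no sequence of reals `(a i)` with
`a i ≥ 2` for all `i ≥ 1` such that the diagonal sequence `d 0 = 1`, `d 1 = a 1`,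
`d (i+1) = a (i+1) * d i - d (i-1)` satisfies `d (m+1) = 1` and `d (m+2) = 0`.
(Consequently the entries of the first row of a frieze pattern of width `m`
cannot all be `≥ 2`.) -/
theorem no_frieze_first_row_all_ge_two (m : ℕ) (hm : 1 ≤ m) :
    ¬ ∃ a d : ℕ → ℝ,
      (∀ i, 1 ≤ i → 2 ≤ a i) ∧
      d 0 = 1 ∧ d 1 = a 1 ∧
      (∀ i, 1 ≤ i → d (i + 1) = a (i + 1) * d i - d (i - 1)) ∧
      d (m + 1) = 1 ∧ d (m + 2) = 0 := by
  rintro ⟨a, d, ha, h0, h1, hd, -, hzero⟩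
  have h := (one_le_and_le_succ_of_diagonal ha h0 h1 hd (m + 2)).1
  linarith
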